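/- arXiv:1206.5061 — 3 statements merged into one kernel-verified Lean document; each statement's English description precedes it below -/
import Mathlib

section
/- Fix c ∈ ℝ and set b(x,M) = x_1M_1 + x_2M_2 + x_3M_3, ν(x) = x_1² + x_2² − d(x,x)(a_1x_1² + a_2x_2²). Define L_1 = g^{−1}( M_1 − (b x_1/(x,x))(1 + x_3²/ν) ) + c x_1/(x_1²+x_2²), L_2 = g^{−1}( M_2 − (b x_2/(x,x))(1 + x_3²/ν) ) + c x_2/(x_1²+x_2²), and L_3 = g^{−1}( M_3 − (b x_3/(x,x))(1 − (x_1²+x_2²)/ν) ). Then on the open subset of U where (x,x) ≠ 0, ν ≠ 0 and x_1²+x_2² ≠ 0, the map reduces the Chaplygin bracket to the canonical Lie–Poisson bracket of e*(3): {L_i, L_j}_g = ε_{ijk} L_k and {L_i, x_j}_g = ε_{ijk} x_k (summation over k); moreover (x,L) = x_1L_1 + x_2L_2 + x_3L_3 = c identically there. -/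
open scoped BigOperators

noncomputable section

abbrev Pt3 : Type := (Fin 3 → ℝ) × (Fin 3 → ℝ)

/-- Euclidean scalar product on ℝ³ -/
def dot (a b : Fin 3 → ℝ) : ℝ := ∑ i, a i * b i

/-- totally antisymmetric Levi-Civita symbol on `Fin 3` -/
def eps (i j k : Fin 3) : ℝ :=
  ((((i : ℕ) : ℝ) - ((j : ℕ) : ℝ)) * (((j : ℕ) : ℝ) - ((k : ℕ) : ℝ))
    * (((k : ℕ) : ℝ) - ((i : ℕ) : ℝ))) / 2

/-- vector cross product on ℝ³ -/
def cross (a b : Fin 3 → ℝ) : Fin 3 → ℝ := fun i => ∑ j, ∑ k, eps i j k * a j * b k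

/-- partial derivative in the coordinate `x i` -/
def dx (f : Pt3 → ℝ) (i : Fin 3) (z : Pt3) : ℝ := fderiv ℝ f z (Pi.single i 1, 0)

/-- partial derivative in the coordinate `M i` (second group of coordinates) -/
def dM (f : Pt3 → ℝ) (i : Fin 3) (z : Pt3) : ℝ := fderiv ℝ f z (0, Pi.single i 1)

/-- partial derivative of a function of `x` only -/
def dxg (g : (Fin 3 → ℝ) → ℝ) (i : Fin 3) (x : Fin 3 → ℝ) : ℝ := fderiv ℝ g x (Pi.single i 1)

/-- bracket associated with a skew-symmetric structure matrix π with
`π_{x_i x_j} = 0`, `π_{M_i x_j} = Axm i j`, `π_{M_i M_j} = Bmm i j`. -/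
def piBracket (Axm Bmm : Fin 3 → Fin 3 → Pt3 → ℝ) (f h : Pt3 → ℝ) (z : Pt3) : ℝ :=
  ∑ i, ∑ j,
    (dM f i z * Axm i j z * dx h j z - dx f j z * Axm i j z * dM h i z
      + dM f i z * Bmm i j z * dM h j z)

/-- `g(x) = √(1 - d (x, A x))` with `A = diag a` -/
def gC (a : Fin 3 → ℝ) (d : ℝ) (x : Fin 3 → ℝ) : ℝ :=
  Real.sqrt (1 - d * dot x (fun i => a i * x i))

/-- the open set `U = {1 - d (x, A x) > 0}` -/
def Uset (a : Fin 3 → ℝ) (d : ℝ) : Set Pt3 :=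
  {z | 1 - d * dot z.1 (fun i => a i * z.1 i) > 0}

/-- `π_{M_i x_j} = ε_{ijk} g x_k` (summation over `k`) -/
def AxmC (a : Fin 3 → ℝ) (d : ℝ) (i j : Fin 3) (z : Pt3) : ℝ :=
  ∑ k, eps i j k * gC a d z.1 * z.1 k

/-- `π_{M_i M_j} = ε_{ijk} ( g M_k - (d (M, A x) / g) x_k )` (summation over `k`) -/
def BmmC (a : Fin 3 → ℝ) (d : ℝ) (i j : Fin 3) (z : Pt3) : ℝ :=
  ∑ k, eps i j k * (gC a d z.1 * z.2 k
    - d * dot z.2 (fun m => a m * z.1 m) / gC a d z.1 * z.1 k)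

/-- the Chaplygin bracket {·,·}_g -/
def chBracket (a : Fin 3 → ℝ) (d : ℝ) (f h : Pt3 → ℝ) (z : Pt3) : ℝ :=
  piBracket (AxmC a d) (BmmC a d) f h z

/-- `ω = A_g M = A M + d g⁻² (x, A M) A x` -/
def omC (a : Fin 3 → ℝ) (d : ℝ) (z : Pt3) : Fin 3 → ℝ := fun i =>
  a i * z.2 i + d / (gC a d z.1) ^ 2 * dot z.1 (fun j => a j * z.2 j) * (a i * z.1 i)

/-- the Chaplygin vector field `Z(x,M) = (x × ω, M × ω)` -/
def Zch (a : Fin 3 → ℝ) (d : ℝ) (z : Pt3) : Pt3 :=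
  (cross z.1 (omC a d z), cross z.2 (omC a d z))

/-- `b = (x, M)` -/
def bC (z : Pt3) : ℝ := dot z.1 z.2

/-- `ν = x₁² + x₂² - d (x,x)(a₁x₁² + a₂x₂²)` -/
def nuC (a : Fin 3 → ℝ) (d : ℝ) (z : Pt3) : ℝ :=
  z.1 0 ^ 2 + z.1 1 ^ 2 - d * dot z.1 z.1 * (a 0 * z.1 0 ^ 2 + a 1 * z.1 1 ^ 2)

/-- the functions `L₁, L₂, L₃` of the reducing Poisson map -/
def Lch (a : Fin 3 → ℝ) (d c : ℝ) : Fin 3 → Pt3 → ℝ := fun i z =>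
  if i = 2 then
    (gC a d z.1)⁻¹ *
      (z.2 2 - bC z * z.1 2 / dot z.1 z.1 * (1 - (z.1 0 ^ 2 + z.1 1 ^ 2) / nuC a d z))
  else
    (gC a d z.1)⁻¹ * (z.2 i - bC z * z.1 i / dot z.1 z.1 * (1 + z.1 2 ^ 2 / nuC a d z))
      + c * z.1 i / (z.1 0 ^ 2 + z.1 1 ^ 2)

/-- `f` is differentiable at `z`, with partial derivatives `p` in the `x` coordinates and `q` in
the `M` coordinates. -/
structure HasGrad (f : Pt3 → ℝ) (p q : Fin 3 → ℝ) (z : Pt3) : Prop where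
  differentiableAt : DifferentiableAt ℝ f z
  dx_eq : ∀ m, dx f m z = p m
  dM_eq : ∀ m, dM f m z = q m

namespace HasGrad

variable {f h : Pt3 → ℝ} {p q p' q' : Fin 3 → ℝ} {z : Pt3}

theorem of_eq (hf : HasGrad f p q z) (hp : ∀ m, p m = p' m) (hq : ∀ m, q m = q' m) :
    HasGrad f p' q' z := by
  rwa [← funext hp, ← funext hq]

theorem congr_of_eventuallyEq (hf : HasGrad f p q z) (hfh : h =ᶠ[nhds z] f) :
    HasGrad h p q z :=
  ⟨hf.1.congr_of_eventuallyEq hfh,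
    fun m => by rw [← hf.2 m, dx, dx, hfh.fderiv_eq],
    fun m => by rw [← hf.3 m, dM, dM, hfh.fderiv_eq]⟩

theorem const (k : ℝ) : HasGrad (fun _ => k) (fun _ => 0) (fun _ => 0) z :=
  ⟨by fun_prop, fun m => by simp [dx], fun m => by simp [dM]⟩

theorem position (j : Fin 3) :
    HasGrad (fun w => w.1 j) (fun m => if m = j then 1 else 0) (fun _ => 0) z := by
  have H : HasFDerivAt (fun w : Pt3 => w.1 j)
      ((ContinuousLinearMap.proj j).comp (ContinuousLinearMap.fst ℝ (Fin 3 → ℝ) (Fin 3 → ℝ))) z :=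
    ContinuousLinearMap.hasFDerivAt ((ContinuousLinearMap.proj j).comp
      (ContinuousLinearMap.fst ℝ (Fin 3 → ℝ) (Fin 3 → ℝ)))
  refine ⟨H.differentiableAt, fun m => ?_, fun m => ?_⟩
  · simp [dx, H.fderiv, Pi.single_apply, eq_comm]
  · simp [dM, H.fderiv]

theorem momentum (j : Fin 3) :
    HasGrad (fun w => w.2 j) (fun _ => 0) (fun m => if m = j then 1 else 0) z := by
  have H : HasFDerivAt (fun w : Pt3 => w.2 j)
      ((ContinuousLinearMap.proj j).comp (ContinuousLinearMap.snd ℝ (Fin 3 → ℝ) (Fin 3 → ℝ))) z :=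
    ContinuousLinearMap.hasFDerivAt ((ContinuousLinearMap.proj j).comp
      (ContinuousLinearMap.snd ℝ (Fin 3 → ℝ) (Fin 3 → ℝ)))
  refine ⟨H.differentiableAt, fun m => ?_, fun m => ?_⟩
  · simp [dx, H.fderiv]
  · simp [dM, H.fderiv, Pi.single_apply, eq_comm]

theorem add (hf : HasGrad f p q z) (hh : HasGrad h p' q' z) :
    HasGrad (fun w => f w + h w) (fun m => p m + p' m) (fun m => q m + q' m) z := by
  have H : HasFDerivAt (fun w => f w + h w) _ z := hf.1.hasFDerivAt.add hh.1.hasFDerivAt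
  refine ⟨H.differentiableAt, fun m => ?_, fun m => ?_⟩
  · rw [← hf.2, ← hh.2, dx, HasFDerivAt.fderiv H]; rfl
  · rw [← hf.3, ← hh.3, dM, HasFDerivAt.fderiv H]; rfl

theorem mul (hf : HasGrad f p q z) (hh : HasGrad h p' q' z) :
    HasGrad (fun w => f w * h w) (fun m => f z * p' m + h z * p m)
      (fun m => f z * q' m + h z * q m) z := by
  have H : HasFDerivAt (fun w => f w * h w) _ z := hf.1.hasFDerivAt.mul hh.1.hasFDerivAt
  refine ⟨H.differentiableAt, fun m => ?_, fun m => ?_⟩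
  · rw [← hf.2, ← hh.2, dx, HasFDerivAt.fderiv H]; rfl
  · rw [← hf.3, ← hh.3, dM, HasFDerivAt.fderiv H]; rfl

theorem comp {φ : ℝ → ℝ} {φ' : ℝ} (hφ : HasDerivAt φ φ' (f z)) (hf : HasGrad f p q z) :
    HasGrad (fun w => φ (f w)) (fun m => φ' * p m) (fun m => φ' * q m) z := by
  have H : HasFDerivAt (fun w => φ (f w)) _ z := hφ.comp_hasFDerivAt z hf.1.hasFDerivAt
  refine ⟨H.differentiableAt, fun m => ?_, fun m => ?_⟩
  · rw [← hf.2, dx, HasFDerivAt.fderiv H]; rfl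
  · rw [← hf.3, dM, HasFDerivAt.fderiv H]; rfl

theorem inv (hf : HasGrad f p q z) (hz : f z ≠ 0) :
    HasGrad (fun w => (f w)⁻¹) (fun m => -(f z ^ 2)⁻¹ * p m) (fun m => -(f z ^ 2)⁻¹ * q m) z :=
  comp (hasDerivAt_inv hz) hf

theorem sum {F : Fin 3 → Pt3 → ℝ} {P Q : Fin 3 → Fin 3 → ℝ}
    (hF : ∀ k, HasGrad (F k) (P k) (Q k) z) :
    HasGrad (fun w => ∑ k, F k w) (fun m => ∑ k, P k m) (fun m => ∑ k, Q k m) z := by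
  simpa only [Fin.sum_univ_three] using ((hF 0).add (hF 1)).add (hF 2)

theorem quadratic (k : Fin 3 → ℝ) :
    HasGrad (fun w => ∑ i, k i * w.1 i ^ 2) (fun m => 2 * k m * z.1 m) (fun _ => 0) z := by
  have H := sum (z := z) fun i => (const (k i)).mul ((position i).mul (position i))
  simp only [← pow_two] at H
  refine H.of_eq (fun m => ?_) fun m => by simp
  fin_cases m <;> simp [Fin.sum_univ_three] <;> ring

theorem bC : HasGrad bC z.2 z.1 z := by
  have H := sum (z := z) fun i => (position i).mul (momentum i)
  refine H.of_eq (fun m => ?_) fun m => ?_ <;> fin_cases m <;> simp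

theorem inv_gC {a : Fin 3 → ℝ} {d : ℝ} (hz : z ∈ Uset a d) :
    HasGrad (fun w => (gC a d w.1)⁻¹) (fun m => d * (gC a d z.1)⁻¹ ^ 3 * a m * z.1 m)
      (fun _ => 0) z := by
  have hg : 0 < gC a d z.1 := Real.sqrt_pos.2 hz
  have H := (const (z := z) 1).add ((const (-d)).mul (quadratic a))
  have e : ∀ w : Pt3, 1 + -d * ∑ i, a i * w.1 i ^ 2 = 1 - d * dot w.1 fun i => a i * w.1 i := by
    intro w
    simp only [dot, Fin.sum_univ_three]
    ring
  simp only [e] at H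
  have H' := (comp (Real.hasDerivAt_sqrt (ne_of_gt hz)) H).inv hg.ne'
  refine H'.of_eq (fun m => ?_) fun m => by simp
  change -(gC a d z.1 ^ 2)⁻¹ * (1 / (2 * gC a d z.1) * _) = _
  field_simp
  ring

end HasGrad

/-- The indicator of the first two coordinates. -/
def planar (i : Fin 3) : ℝ := if i = 2 then 0 else 1

/-- The coefficient of `(x, M)` in `g L_i`, with the factor `(x, x)` cancelled. -/
def bCoeff (a : Fin 3 → ℝ) (d : ℝ) (i : Fin 3) (z : Pt3) : ℝ :=
  z.1 i * (d * ∑ k, planar k * a k * z.1 k ^ 2 + -planar i) * (nuC a d z)⁻¹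

/-- The vector field `c⁻¹ (L - L|_{c = 0})`. -/
def planarDir (i : Fin 3) (z : Pt3) : ℝ :=
  planar i * z.1 i * (∑ k, planar k * z.1 k ^ 2)⁻¹

theorem nuC_eq (a : Fin 3 → ℝ) (d : ℝ) (z : Pt3) :
    nuC a d z = ∑ k, planar k * z.1 k ^ 2 +
      -d * ((∑ k, 1 * z.1 k ^ 2) * ∑ k, planar k * a k * z.1 k ^ 2) := by
  simp [nuC, dot, planar, Fin.sum_univ_three]
  ring

theorem dot_self_ne_zero_of_nuC {a : Fin 3 → ℝ} {d : ℝ} {z : Pt3} (hν : nuC a d z ≠ 0) :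
    dot z.1 z.1 ≠ 0 := by
  intro h
  have h0 : z.1 0 = 0 := by
    simp only [dot, Fin.sum_univ_three] at h
    nlinarith [sq_nonneg (z.1 0), sq_nonneg (z.1 1), sq_nonneg (z.1 2)]
  have h1 : z.1 1 = 0 := by
    simp only [dot, Fin.sum_univ_three] at h
    nlinarith [sq_nonneg (z.1 0), sq_nonneg (z.1 1), sq_nonneg (z.1 2)]
  exact hν (by simp [nuC, h0, h1])

theorem Lch_eq (a : Fin 3 → ℝ) (d c : ℝ) (i : Fin 3) {z : Pt3} (hν : nuC a d z ≠ 0) :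
    Lch a d c i z = (gC a d z.1)⁻¹ * (z.2 i + bC z * bCoeff a d i z) + c * planarDir i z := by
  have hr := dot_self_ne_zero_of_nuC hν
  have hr' : dot z.1 z.1 = z.1 0 ^ 2 + z.1 1 ^ 2 + z.1 2 ^ 2 := by
    simp only [dot, Fin.sum_univ_three]
    ring
  have hν' : nuC a d z = z.1 0 ^ 2 + z.1 1 ^ 2
      - d * dot z.1 z.1 * (a 0 * z.1 0 ^ 2 + a 1 * z.1 1 ^ 2) := rfl
  have h1 : 1 / dot z.1 z.1 * (1 + z.1 2 ^ 2 / nuC a d z)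
      = (1 - d * (a 0 * z.1 0 ^ 2 + a 1 * z.1 1 ^ 2)) / nuC a d z := by
    field_simp
    rw [hν', hr']
    ring
  have h2 : 1 / dot z.1 z.1 * (1 - (z.1 0 ^ 2 + z.1 1 ^ 2) / nuC a d z)
      = -(d * (a 0 * z.1 0 ^ 2 + a 1 * z.1 1 ^ 2)) / nuC a d z := by
    field_simp
    rw [hν', hr']
    ring
  fin_cases i <;> simp [Lch, bCoeff, planarDir, planar, Fin.sum_univ_three, -mul_eq_mul_left_iff]
  · linear_combination -(gC a d z.1)⁻¹ * bC z * z.1 0 * h1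
  · linear_combination -(gC a d z.1)⁻¹ * bC z * z.1 1 * h1
  · linear_combination -(gC a d z.1)⁻¹ * bC z * z.1 2 * h2

theorem hasGrad_nuC (a : Fin 3 → ℝ) (d : ℝ) (z : Pt3) :
    HasGrad (nuC a d) (fun m => 2 * z.1 m * (planar m * (1 - d * dot z.1 z.1 * a m)
      - d * ∑ k, planar k * a k * z.1 k ^ 2)) (fun _ => 0) z := by
  have H := (HasGrad.quadratic (z := z) planar).add ((HasGrad.const (-d)).mul
    ((HasGrad.quadratic fun _ => 1).mul (HasGrad.quadratic fun k => planar k * a k)))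
  simp only [← nuC_eq] at H
  refine H.of_eq (fun m => ?_) fun m => by simp
  simp only [dot, Fin.sum_univ_three]
  ring

theorem hasGrad_bCoeff {a : Fin 3 → ℝ} {d : ℝ} {z : Pt3} (i : Fin 3) (hν : nuC a d z ≠ 0) :
    HasGrad (bCoeff a d i) (fun m =>
      ((if m = i then 1 else 0) * (d * ∑ k, planar k * a k * z.1 k ^ 2 - planar i)
        + 2 * d * z.1 i * planar m * a m * z.1 m) / nuC a d z
      - z.1 i * (d * ∑ k, planar k * a k * z.1 k ^ 2 - planar i)
        * (2 * z.1 m * (planar m * (1 - d * dot z.1 z.1 * a m)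
          - d * ∑ k, planar k * a k * z.1 k ^ 2)) / nuC a d z ^ 2) (fun _ => 0) z := by
  have H := ((HasGrad.position (z := z) i).mul (((HasGrad.const d).mul
    (HasGrad.quadratic fun k => planar k * a k)).add (HasGrad.const (-planar i)))).mul
    ((hasGrad_nuC a d z).inv hν)
  refine H.of_eq (fun m => ?_) fun m => by simp
  field_simp
  ring

theorem hasGrad_planarDir {z : Pt3} (i : Fin 3) (hρ : ∑ k, planar k * z.1 k ^ 2 ≠ 0) :
    HasGrad (planarDir i) (fun m =>
      planar i * (if m = i then 1 else 0) / (∑ k, planar k * z.1 k ^ 2)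
      - 2 * planar i * z.1 i * planar m * z.1 m / (∑ k, planar k * z.1 k ^ 2) ^ 2)
      (fun _ => 0) z := by
  have H := ((HasGrad.const (z := z) (planar i)).mul (HasGrad.position i)).mul
    ((HasGrad.quadratic planar).inv hρ)
  refine H.of_eq (fun m => ?_) fun m => by simp
  field_simp
  ring

/-- The rotation operators `f ↦ ∇f × x` applied to the components of a vector field with
Jacobian `F'`, antisymmetrized. -/
def rotBracket (F' : Fin 3 → Fin 3 → ℝ) (x : Fin 3 → ℝ) (i j : Fin 3) : ℝ :=
  cross (F' j) x i - cross (F' i) x j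

theorem hasGrad_Lch {a : Fin 3 → ℝ} {d c : ℝ} {z : Pt3} {R' Q' : Fin 3 → ℝ} (i : Fin 3)
    (hz : z ∈ Uset a d) (hν : nuC a d z ≠ 0)
    (hR : HasGrad (bCoeff a d i) R' (fun _ => 0) z)
    (hQ : HasGrad (planarDir i) Q' (fun _ => 0) z) :
    HasGrad (Lch a d c i)
      (fun m => d * (gC a d z.1)⁻¹ ^ 3 * a m * z.1 m * (z.2 i + bC z * bCoeff a d i z)
        + (gC a d z.1)⁻¹ * (z.2 m * bCoeff a d i z + bC z * R' m) + c * Q' m)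
      (fun m => (gC a d z.1)⁻¹ * ((if m = i then 1 else 0) + z.1 m * bCoeff a d i z)) z := by
  have H := ((HasGrad.inv_gC hz).mul ((HasGrad.momentum i).add (HasGrad.bC.mul hR))).add
    ((HasGrad.const c).mul hQ)
  refine (H.congr_of_eventuallyEq ?_).of_eq (fun m => by ring) fun m => by ring
  filter_upwards [(hasGrad_nuC a d z).1.continuousAt.eventually_ne hν] with w hw
  exact Lch_eq a d c i hw

theorem chBracket_eq {a : Fin 3 → ℝ} {d : ℝ} {z : Pt3} {f h : Pt3 → ℝ} {p q p' q' : Fin 3 → ℝ}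
    (hf : HasGrad f p q z) (hh : HasGrad h p' q' z) :
    chBracket a d f h z = ∑ i, ∑ j, (q i * AxmC a d i j z * p' j - p j * AxmC a d i j z * q' i
      + q i * BmmC a d i j z * q' j) := by
  simp only [chBracket, piBracket, hf.2, hf.3, hh.2, hh.3]

theorem chBracket_Lch_position {a : Fin 3 → ℝ} {d c : ℝ} {z : Pt3} (i j : Fin 3)
    (hz : z ∈ Uset a d) (hν : nuC a d z ≠ 0) (hρ : ∑ k, planar k * z.1 k ^ 2 ≠ 0) :
    chBracket a d (Lch a d c i) (fun w => w.1 j) z = ∑ k, eps i j k * z.1 k := by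
  have hg : gC a d z.1 ≠ 0 := (Real.sqrt_pos.2 hz).ne'
  rw [chBracket_eq (hasGrad_Lch i hz hν (hasGrad_bCoeff i hν) (hasGrad_planarDir i hρ))
    (HasGrad.position j)]
  generalize bCoeff a d i z = r
  fin_cases i <;> fin_cases j <;> simp [AxmC, eps, Fin.sum_univ_three] <;> field_simp <;> ring

theorem rotBracket_planarDir {z : Pt3} (hρ : ∑ k, planar k * z.1 k ^ 2 ≠ 0) (i j : Fin 3) :
    rotBracket (fun i m => planar i * (if m = i then 1 else 0) / (∑ k, planar k * z.1 k ^ 2)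
      - 2 * planar i * z.1 i * planar m * z.1 m / (∑ k, planar k * z.1 k ^ 2) ^ 2) z.1 i j
      = ∑ k, eps i j k * planarDir k z := by
  simp only [rotBracket, cross, planarDir]
  generalize hs : ∑ k, planar k * z.1 k ^ 2 = s at *
  simp [Fin.sum_univ_three, planar] at hs
  fin_cases i <;> fin_cases j <;> simp [planar, eps, Fin.sum_univ_three] <;> field_simp <;>
    (try rw [← hs]) <;> ring

theorem rotBracket_bCoeff {a : Fin 3 → ℝ} {d : ℝ} {z : Pt3} (hz : z ∈ Uset a d)
    (hν : nuC a d z ≠ 0) (i j : Fin 3) :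
    rotBracket (fun i m =>
      ((if m = i then 1 else 0) * (d * ∑ k, planar k * a k * z.1 k ^ 2 - planar i)
        + 2 * d * z.1 i * planar m * a m * z.1 m) / nuC a d z
      - z.1 i * (d * ∑ k, planar k * a k * z.1 k ^ 2 - planar i)
        * (2 * z.1 m * (planar m * (1 - d * dot z.1 z.1 * a m)
          - d * ∑ k, planar k * a k * z.1 k ^ 2)) / nuC a d z ^ 2) z.1 i j
      = ∑ k, eps i j k * (bCoeff a d k z
        - d * z.1 k * (∑ m, bCoeff a d m z * a m * z.1 m) * (gC a d z.1)⁻¹ ^ 2) := by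
  have hz' : 1 - d * dot z.1 (fun i => a i * z.1 i) ≠ 0 := ne_of_gt hz
  have hg : (gC a d z.1)⁻¹ ^ 2 = (1 - d * dot z.1 (fun i => a i * z.1 i))⁻¹ := by
    rw [inv_pow, gC, Real.sq_sqrt (le_of_lt hz)]
  rw [hg]
  simp only [rotBracket, cross, bCoeff]
  generalize hG : 1 - d * dot z.1 (fun i => a i * z.1 i) = G at *
  generalize hn : nuC a d z = n at *
  simp [dot, Fin.sum_univ_three] at hG
  simp [nuC, dot, Fin.sum_univ_three] at hn
  fin_cases i <;> fin_cases j <;> simp [planar, eps, dot, Fin.sum_univ_three] <;> field_simp <;>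
    (try rw [← hG, ← hn]) <;> ring

theorem sum_mul_bCoeff {a : Fin 3 → ℝ} {d : ℝ} {z : Pt3} (hν : nuC a d z ≠ 0) :
    ∑ i, z.1 i * bCoeff a d i z = -1 := by
  simp only [bCoeff, Fin.sum_univ_three]
  field_simp
  simp [nuC, dot, planar, Fin.sum_univ_three]
  ring

theorem sum_mul_planarDir {z : Pt3} (hρ : ∑ k, planar k * z.1 k ^ 2 ≠ 0) :
    ∑ i, z.1 i * planarDir i z = 1 := by
  have h : ∑ i, z.1 i * planarDir i z
      = (∑ k, planar k * z.1 k ^ 2) * (∑ k, planar k * z.1 k ^ 2)⁻¹ := by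
    simp only [planarDir]
    rw [Finset.sum_mul]
    exact Finset.sum_congr rfl fun k _ => by ring
  rw [h, mul_inv_cancel₀ hρ]

set_option maxHeartbeats 1000000 in
theorem chBracket_Lch_Lch {a : Fin 3 → ℝ} {d c : ℝ} {z : Pt3} {R' Q' : Fin 3 → Fin 3 → ℝ}
    (hz : z ∈ Uset a d) (hν : nuC a d z ≠ 0)
    (hR : ∀ i, HasGrad (bCoeff a d i) (R' i) (fun _ => 0) z)
    (hQ : ∀ i, HasGrad (planarDir i) (Q' i) (fun _ => 0) z)
    (hR' : ∀ i j, rotBracket R' z.1 i j = ∑ k, eps i j k * (bCoeff a d k z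
        - d * z.1 k * (∑ m, bCoeff a d m z * a m * z.1 m) * (gC a d z.1)⁻¹ ^ 2))
    (hQ' : ∀ i j, rotBracket Q' z.1 i j = ∑ k, eps i j k * planarDir k z) (i j : Fin 3) :
    chBracket a d (Lch a d c i) (Lch a d c j) z = ∑ k, eps i j k * Lch a d c k z := by
  have hg : gC a d z.1 ≠ 0 := (Real.sqrt_pos.2 hz).ne'
  have h3 := congrArg (fun t => (∑ k, eps i j k * a k * z.1 k) * t) (sum_mul_bCoeff hν)
  rw [chBracket_eq (hasGrad_Lch i hz hν (hR i) (hQ i)) (hasGrad_Lch j hz hν (hR j) (hQ j))]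
  simp only [Lch_eq a d c _ hν]
  have h1 := hR' i j
  have h2 := hQ' i j
  simp only [AxmC, BmmC, bC, dot, rotBracket, cross] at h1 h2 ⊢
  generalize gC a d z.1 = g at *
  clear hR hQ hR' hQ'
  fin_cases i <;> fin_cases j <;>
  · linear_combination (norm := skip) (∑ k, z.1 k * z.2 k) * g⁻¹ * h1 + c * h2
      - d * g⁻¹ ^ 3 * (∑ k, z.1 k * z.2 k) * h3
    simp [eps, Fin.sum_univ_three]
    field_simp
    ring

/-- the Poisson map `L` reduces the Chaplygin bracket to the canonical
Lie-Poisson bracket of `e*(3)`, and `(x, L) = c`. -/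
theorem chaplygin_reduction (a : Fin 3 → ℝ) (d c : ℝ) :
    ∀ z : Pt3, z ∈ Uset a d → dot z.1 z.1 ≠ 0 → nuC a d z ≠ 0 →
      z.1 0 ^ 2 + z.1 1 ^ 2 ≠ 0 →
      (∀ i j : Fin 3,
        chBracket a d (Lch a d c i) (Lch a d c j) z = ∑ k, eps i j k * Lch a d c k z)
      ∧ (∀ i j : Fin 3,
        chBracket a d (Lch a d c i) (fun w => w.1 j) z = ∑ k, eps i j k * z.1 k)
      ∧ (∑ i, z.1 i * Lch a d c i z = c) := by
  intro z hz _ hν hρ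
  replace hρ : ∑ k, planar k * z.1 k ^ 2 ≠ 0 := by
    simpa [planar, Fin.sum_univ_three] using hρ
  refine ⟨chBracket_Lch_Lch hz hν (fun i => hasGrad_bCoeff i hν)
    (fun i => hasGrad_planarDir i hρ) (rotBracket_bCoeff hz hν) (rotBracket_planarDir hρ),
    fun i j => chBracket_Lch_position i j hz hν hρ, ?_⟩
  have hr := sum_mul_bCoeff hν
  have hq := sum_mul_planarDir hρ
  have hb : bC z = ∑ i, z.1 i * z.2 i := rfl
  simp only [Lch_eq a d c _ hν]
  simp only [Fin.sum_univ_three] at hr hq hb ⊢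
  linear_combination (gC a d z.1)⁻¹ * bC z * hr + c * hq - (gC a d z.1)⁻¹ * hb
end
end

section
/- The four functions H_1 = (M, A_gM), H_2 = (M,M), H_3 = (x,x), H_4 = (x,M) are first integrals of the Chaplygin ball equations: for every point of U, the derivative of each H_i along the Chaplygin vector field Z(x,M) = (x × ω, M × ω) vanishes, i.e. ⟨∇H_i(x,M), Z(x,M)⟩ = 0 for i = 1,2,3,4. -/
open scoped BigOperators

noncomputable section

theorem hasFDerivAt_dot {E : Type*} [NormedAddCommGroup E] [NormedSpace ℝ E]
    {f g : E → Fin 3 → ℝ} {f' g' : E →L[ℝ] Fin 3 → ℝ} {z : E}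
    (hf : HasFDerivAt f f' z) (hg : HasFDerivAt g g' z) :
    HasFDerivAt (fun w => dot (f w) (g w))
      (∑ i, (f z i • (ContinuousLinearMap.proj (R := ℝ) (φ := fun _ => ℝ) i).comp g'
        + g z i • (ContinuousLinearMap.proj (R := ℝ) (φ := fun _ => ℝ) i).comp f')) z :=
  HasFDerivAt.fun_sum fun i _ => (hasFDerivAt_pi'.1 hf i).mul (hasFDerivAt_pi'.1 hg i)

theorem fderiv_dot_apply {E : Type*} [NormedAddCommGroup E] [NormedSpace ℝ E]
    (f g : E →L[ℝ] Fin 3 → ℝ) (z v : E) :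
    fderiv ℝ (fun w => dot (f w) (g w)) z v = dot (f z) (g v) + dot (g z) (f v) := by
  rw [(hasFDerivAt_dot f.hasFDerivAt g.hasFDerivAt).fderiv]
  simp [dot, Finset.sum_add_distrib]

theorem dot_cross_add_dot_cross (x y w : Fin 3 → ℝ) :
    dot x (cross y w) + dot y (cross x w) = 0 := by
  simp [dot, cross, eps, Fin.sum_univ_three]
  ring

theorem dot_cross_right_self (x w : Fin 3 → ℝ) : dot w (cross x w) = 0 := by
  simp [dot, cross, eps, Fin.sum_univ_three]
  ring

/-- multiplication by the diagonal matrix `diag a` -/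
def diagCLM (a : Fin 3 → ℝ) : (Fin 3 → ℝ) →L[ℝ] Fin 3 → ℝ :=
  ContinuousLinearMap.pi fun i => a i • ContinuousLinearMap.proj i

theorem diagCLM_apply (a x : Fin 3 → ℝ) : diagCLM a x = fun i => a i * x i := rfl

theorem differentiable_dot_clm {E : Type*} [NormedAddCommGroup E] [NormedSpace ℝ E]
    (f g : E →L[ℝ] Fin 3 → ℝ) : Differentiable ℝ fun w => dot (f w) (g w) := fun _ =>
  (hasFDerivAt_dot f.hasFDerivAt g.hasFDerivAt).differentiableAt

theorem omC_apply_of_mem (a : Fin 3 → ℝ) (d : ℝ) {z : Pt3} (hz : z ∈ Uset a d) (i : Fin 3) :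
    omC a d z i = a i * z.2 i + d / (1 - d * dot z.1 (diagCLM a z.1))
      * dot z.1 (diagCLM a z.2) * (a i * z.1 i) := by
  have hz' : 0 < 1 - d * dot z.1 (fun i => a i * z.1 i) := hz
  simp only [omC, gC, Real.sq_sqrt hz'.le, diagCLM_apply]

/-- On `U`, `(M, A_g M) = (M, A M) + d (x, A M)² / (1 - d (x, A x))`. -/
theorem dot_omC (a : Fin 3 → ℝ) (d : ℝ) {z : Pt3} (hz : z ∈ Uset a d) :
    dot z.2 (omC a d z) = dot z.2 (diagCLM a z.2)
      + d * dot z.1 (diagCLM a z.2) ^ 2 / (1 - d * dot z.1 (diagCLM a z.1)) := by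
  simp only [dot, omC_apply_of_mem a d hz, diagCLM_apply, Fin.sum_univ_three]
  ring

theorem isOpen_Uset (a : Fin 3 → ℝ) (d : ℝ) : IsOpen (Uset a d) := by
  apply isOpen_lt continuous_const
  unfold dot
  fun_prop

/-- The differential of `(M, A_g M)` in the direction `v` is
`2 (ω, v_M) + 2 d g⁻² (x, A M) (ω, v_x)`. -/
theorem fderiv_dot_omC_apply (a : Fin 3 → ℝ) (d : ℝ) {z : Pt3} (hz : z ∈ Uset a d) (v : Pt3) :
    fderiv ℝ (fun w => dot w.2 (omC a d w)) z v = 2 * dot (omC a d z) v.2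
      + 2 * (d / gC a d z.1 ^ 2 * dot z.1 (fun j => a j * z.2 j)) * dot (omC a d z) v.1 := by
  have hz' : 0 < 1 - d * dot z.1 (fun i => a i * z.1 i) := hz
  have hev : (fun w => dot w.2 (omC a d w)) =ᶠ[nhds z] fun w => dot w.2 (diagCLM a w.2)
      + d * dot w.1 (diagCLM a w.2) ^ 2 / (1 - d * dot w.1 (diagCLM a w.1)) := by
    filter_upwards [(isOpen_Uset a d).mem_nhds hz] with w hw using dot_omC a d hw
  let X := ContinuousLinearMap.fst ℝ (Fin 3 → ℝ) (Fin 3 → ℝ)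
  let M := ContinuousLinearMap.snd ℝ (Fin 3 → ℝ) (Fin 3 → ℝ)
  have h1 := (differentiable_dot_clm M ((diagCLM a).comp M) z).hasFDerivAt
  have h2 := (differentiable_dot_clm X ((diagCLM a).comp M) z).hasFDerivAt
  have h3 := (differentiable_dot_clm X ((diagCLM a).comp X) z).hasFDerivAt
  have h := h1.add (((h2.pow 2).const_mul d).mul
    ((hasDerivAt_inv hz'.ne').comp_hasFDerivAt z ((h3.const_mul d).const_sub 1)))
  have hv := congrArg (· v) (hev.hasFDerivAt_iff.2 h).fderiv
  refine hv.trans ?_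
  simp only [add_apply, smul_apply,
    neg_apply, fderiv_dot_apply, smul_eq_mul, gC, Real.sq_sqrt hz'.le]
  simp only [X, M, ContinuousLinearMap.comp_apply, ContinuousLinearMap.coe_fst',
    ContinuousLinearMap.coe_snd', diagCLM_apply, Function.comp_apply]
  simp only [← inv_pow, dot, omC_apply_of_mem a d hz, diagCLM_apply, Fin.sum_univ_three]
  ring

/-- `H₁ = (M, A_g M)`, `H₂ = (M,M)`, `H₃ = (x,x)`, `H₄ = (x,M)` are first
integrals of the Chaplygin ball equations. -/
theorem chaplygin_integrals (a : Fin 3 → ℝ) (d : ℝ) :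
    ∀ z : Pt3, z ∈ Uset a d →
      fderiv ℝ (fun w => dot w.2 (omC a d w)) z (Zch a d z) = 0
      ∧ fderiv ℝ (fun w => dot w.2 w.2) z (Zch a d z) = 0
      ∧ fderiv ℝ (fun w => dot w.1 w.1) z (Zch a d z) = 0
      ∧ fderiv ℝ (fun w => dot w.1 w.2) z (Zch a d z) = 0 := by
  intro z hz
  refine ⟨?_, ?_, ?_, ?_⟩
  · rw [fderiv_dot_omC_apply a d hz]
    simp [Zch, dot_cross_right_self]
  · refine (fderiv_dot_apply (.snd ℝ _ _) (.snd ℝ _ _) z (Zch a d z)).trans ?_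
    exact dot_cross_add_dot_cross ..
  · refine (fderiv_dot_apply (.fst ℝ _ _) (.fst ℝ _ _) z (Zch a d z)).trans ?_
    exact dot_cross_add_dot_cross ..
  · refine (fderiv_dot_apply (.fst ℝ _ _) (.snd ℝ _ _) z (Zch a d z)).trans ?_
    exact dot_cross_add_dot_cross ..
end
end

section
/- The Veselova bracket {·,·}_v on W satisfies the Jacobi identity: for all smooth functions f, h, k on W, {f,{h,k}_v}_v + {h,{k,f}_v}_v + {k,{f,h}_v}_v = 0 identically on W; in particular it is a Poisson bracket. -/
open scoped BigOperators

noncomputable section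

/-- `ĝ(x) = (x, Â x)^{1/2}` -/
def ghat (ah : Fin 3 → ℝ) (x : Fin 3 → ℝ) : ℝ :=
  Real.sqrt (dot x (fun i => ah i * x i))

/-- the open set `W = {(x,K) : (x, Â x) > 0}` -/
def Wset (ah : Fin 3 → ℝ) : Set Pt3 :=
  {z | dot z.1 (fun i => ah i * z.1 i) > 0}

/-- `π_{K_i x_j} = ε_{ijk} ĝ x_k` (summation over `k`) -/
def AxmV (ah : Fin 3 → ℝ) (i j : Fin 3) (z : Pt3) : ℝ :=
  ∑ k, eps i j k * ghat ah z.1 * z.1 k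

/-- `π_{K_i K_j} = ε_{ijk} ( ĝ K_k + x_k ( ∑_m K_m ∂ĝ/∂x_m - (x,K)/ĝ ) )`
(summation over `k`) -/
def BmmV (ah : Fin 3 → ℝ) (i j : Fin 3) (z : Pt3) : ℝ :=
  ∑ k, eps i j k * (ghat ah z.1 * z.2 k
    + z.1 k * ((∑ m, z.2 m * dxg (ghat ah) m z.1) - dot z.1 z.2 / ghat ah z.1))

/-- the Veselova bracket {·,·}_v -/
def vesBracket (ah : Fin 3 → ℝ) (f h : Pt3 → ℝ) (z : Pt3) : ℝ :=
  piBracket (AxmV ah) (BmmV ah) f h z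

section CoordinateBracket

variable {ι E : Type*} [Fintype ι] [NormedAddCommGroup E] [NormedSpace ℝ E]

/-- The bracket `∑ a b, (∂f/∂e_a) P_{ab} (∂h/∂e_b)` with structure functions `P`. -/
def coordBracket (e : ι → E) (P : ι → ι → E → ℝ) (f h : E → ℝ) (z : E) : ℝ :=
  ∑ a, ∑ b, fderiv ℝ f z (e a) * P a b z * fderiv ℝ h z (e b)

/-- The Hamiltonian vector field of `f`. -/
def hamVec (e : ι → E) (P : ι → ι → E → ℝ) (f : E → ℝ) (z : E) : E :=
  ∑ a, ∑ b, (fderiv ℝ f z (e a) * P a b z) • e b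

/-- The part of the derivative of `coordBracket e P f h` that comes from the structure functions,
whose derivatives are `P'`. -/
def structTerm (e : ι → E) (P' : ι → ι → E →L[ℝ] ℝ) (f h : E → ℝ) (z v : E) : ℝ :=
  ∑ a, ∑ b, fderiv ℝ f z (e a) * P' a b v * fderiv ℝ h z (e b)

theorem apply_hamVec (e : ι → E) (P : ι → ι → E → ℝ) (f : E → ℝ) (z : E) (L : E →L[ℝ] ℝ) :
    L (hamVec e P f z) = ∑ a, ∑ b, fderiv ℝ f z (e a) * P a b z * L (e b) := by
  simp [hamVec, map_sum]

theorem fderiv_coordBracket_apply {e : ι → E} {P : ι → ι → E → ℝ} {P' : ι → ι → E →L[ℝ] ℝ}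
    {f h : E → ℝ} {z : E} (hskew : ∀ a b, P a b z = -P b a z)
    (hP : ∀ a b, HasFDerivAt (P a b) (P' a b) z)
    (hf : DifferentiableAt ℝ (fderiv ℝ f) z) (hh : DifferentiableAt ℝ (fderiv ℝ h) z) (v : E) :
    fderiv ℝ (coordBracket e P f h) z v =
      fderiv ℝ (fderiv ℝ h) z v (hamVec e P f z) - fderiv ℝ (fderiv ℝ f) z v (hamVec e P h z)
        + structTerm e P' f h z v := by
  have hd : ∀ {u : E → ℝ}, DifferentiableAt ℝ (fderiv ℝ u) z → ∀ a,
      HasFDerivAt (fun y => fderiv ℝ u y (e a)) ((fderiv ℝ (fderiv ℝ u) z).flip (e a)) z := by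
    intro u hu a
    simpa using hu.hasFDerivAt.clm_apply (hasFDerivAt_const (e a) z)
  have key : HasFDerivAt (coordBracket e P f h) _ z :=
    HasFDerivAt.fun_sum (u := Finset.univ) fun a _ => HasFDerivAt.fun_sum (u := Finset.univ)
      fun b _ => ((hd hf a).mul (hP a b)).mul (hd hh b)
  rw [key.fderiv, apply_hamVec, apply_hamVec, structTerm,
    Finset.sum_comm (f := fun a b => fderiv ℝ h z (e a) * P a b z * _)]
  simp only [← Finset.sum_sub_distrib, ← Finset.sum_add_distrib, sum_apply, add_apply,
    smul_apply, smul_eq_mul, ContinuousLinearMap.flip_apply, Pi.mul_apply]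
  refine Finset.sum_congr rfl fun a _ => Finset.sum_congr rfl fun b _ => ?_
  rw [hskew b a]
  ring

/-- The Jacobiator of a skew-symmetric bracket involves only first derivatives. -/
theorem coordBracket_jacobiator {e : ι → E} {P : ι → ι → E → ℝ} {P' : ι → ι → E →L[ℝ] ℝ}
    {f h k : E → ℝ} {z : E} (hskew : ∀ a b, P a b z = -P b a z)
    (hP : ∀ a b, HasFDerivAt (P a b) (P' a b) z)
    (hf : ContDiffAt ℝ 2 f z) (hh : ContDiffAt ℝ 2 h z) (hk : ContDiffAt ℝ 2 k z) :
    coordBracket e P f (coordBracket e P h k) z + coordBracket e P h (coordBracket e P k f) z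
        + coordBracket e P k (coordBracket e P f h) z =
      structTerm e P' h k z (hamVec e P f z) + structTerm e P' k f z (hamVec e P h z)
        + structTerm e P' f h z (hamVec e P k z) := by
  have hd : ∀ {u : E → ℝ}, ContDiffAt ℝ 2 u z → DifferentiableAt ℝ (fderiv ℝ u) z := fun hu =>
    (hu.fderiv_right (m := 1) (by norm_num)).differentiableAt (by norm_num)
  have hs : ∀ {u : E → ℝ}, ContDiffAt ℝ 2 u z → IsSymmSndFDerivAt ℝ u z := fun hu =>
    hu.isSymmSndFDerivAt (by simp)
  have hX : ∀ u w : E → ℝ, coordBracket e P u w z = fderiv ℝ w z (hamVec e P u z) := fun u w =>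
    (apply_hamVec e P u z _).symm
  rw [hX f, hX h, hX k, fderiv_coordBracket_apply hskew hP (hd hh) (hd hk),
    fderiv_coordBracket_apply hskew hP (hd hk) (hd hf),
    fderiv_coordBracket_apply hskew hP (hd hf) (hd hh),
    (hs hf).eq (hamVec e P k z), (hs hh).eq (hamVec e P k z), (hs hk).eq (hamVec e P h z)]
  ring

end CoordinateBracket

/-- The coordinate vectors of `Pt3`: first the `x i`, then the `K i`. -/
def coordVec : Fin 3 ⊕ Fin 3 → Pt3 :=
  Sum.elim (fun i => (Pi.single i 1, 0)) (fun i => (0, Pi.single i 1))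

/-- The full structure matrix of `piBracket`. -/
def structMatrix (Axm Bmm : Fin 3 → Fin 3 → Pt3 → ℝ) : Fin 3 ⊕ Fin 3 → Fin 3 ⊕ Fin 3 → Pt3 → ℝ
  | .inl _, .inl _ => 0
  | .inl j, .inr i => -Axm i j
  | .inr i, .inl j => Axm i j
  | .inr i, .inr j => Bmm i j

/-- The derivative of `structMatrix`, given the derivatives of its blocks. -/
def structMatrixDeriv (A' B' : Fin 3 → Fin 3 → Pt3 →L[ℝ] ℝ) :
    Fin 3 ⊕ Fin 3 → Fin 3 ⊕ Fin 3 → Pt3 →L[ℝ] ℝ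
  | .inl _, .inl _ => 0
  | .inl j, .inr i => -A' i j
  | .inr i, .inl j => A' i j
  | .inr i, .inr j => B' i j

theorem piBracket_eq_coordBracket (Axm Bmm : Fin 3 → Fin 3 → Pt3 → ℝ) (f h : Pt3 → ℝ) :
    piBracket Axm Bmm f h = coordBracket coordVec (structMatrix Axm Bmm) f h := by
  funext z
  simp only [piBracket, coordBracket, Fintype.sum_sum_type, structMatrix, coordVec, Sum.elim_inl,
    Sum.elim_inr, dx, dM, Fin.sum_univ_three, Pi.zero_apply, Pi.neg_apply]
  ring

theorem eps_swap (i j k : Fin 3) : eps j i k = -eps i j k := by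
  unfold eps
  ring

theorem structMatrix_skew {Axm Bmm : Fin 3 → Fin 3 → Pt3 → ℝ} {z : Pt3}
    (hB : ∀ i j, Bmm i j z = -Bmm j i z) (a b : Fin 3 ⊕ Fin 3) :
    structMatrix Axm Bmm a b z = -structMatrix Axm Bmm b a z := by
  rcases a with a | a <;> rcases b with b | b <;> simp [structMatrix, ← hB]

theorem hasFDerivAt_structMatrix {Axm Bmm : Fin 3 → Fin 3 → Pt3 → ℝ}
    {A' B' : Fin 3 → Fin 3 → Pt3 →L[ℝ] ℝ} {z : Pt3}
    (hA : ∀ i j, HasFDerivAt (Axm i j) (A' i j) z) (hB : ∀ i j, HasFDerivAt (Bmm i j) (B' i j) z)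
    (a b : Fin 3 ⊕ Fin 3) :
    HasFDerivAt (structMatrix Axm Bmm a b) (structMatrixDeriv A' B' a b) z := by
  rcases a with a | a <;> rcases b with b | b
  · exact hasFDerivAt_const 0 z
  · exact (hA b a).neg
  · exact hA a b
  · exact hB a b

theorem isOpen_Wset (ah : Fin 3 → ℝ) : IsOpen (Wset ah) :=
  isOpen_lt continuous_const (by unfold dot; fun_prop)

theorem contDiffAt_ghat {ah x : Fin 3 → ℝ} (hx : 0 < dot x (fun i => ah i * x i)) :
    ContDiffAt ℝ 2 (ghat ah) x :=
  ContDiffAt.sqrt (by unfold dot; fun_prop) hx.ne'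

theorem apply_eq_sum_mul_single (L : (Fin 3 → ℝ) →L[ℝ] ℝ) (v : Fin 3 → ℝ) :
    L v = ∑ m, v m * L (Pi.single m 1) := by
  conv_lhs => rw [pi_eq_sum_univ' v]
  simp

theorem hasFDerivAt_fst_apply (z : Pt3) (m : Fin 3) :
    HasFDerivAt (fun y : Pt3 => y.1 m)
      ((ContinuousLinearMap.proj m).comp (ContinuousLinearMap.fst ℝ _ _)) z :=
  ((ContinuousLinearMap.proj m : (Fin 3 → ℝ) →L[ℝ] ℝ).comp
    (ContinuousLinearMap.fst ℝ (Fin 3 → ℝ) (Fin 3 → ℝ))).hasFDerivAt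

theorem hasFDerivAt_snd_apply (z : Pt3) (m : Fin 3) :
    HasFDerivAt (fun y : Pt3 => y.2 m)
      ((ContinuousLinearMap.proj m).comp (ContinuousLinearMap.snd ℝ _ _)) z :=
  ((ContinuousLinearMap.proj m : (Fin 3 → ℝ) →L[ℝ] ℝ).comp
    (ContinuousLinearMap.snd ℝ (Fin 3 → ℝ) (Fin 3 → ℝ))).hasFDerivAt

/-- The scalar coefficient of `x_k` in `π_{K_i K_j}`. -/
def coeffV (ah : Fin 3 → ℝ) (z : Pt3) : ℝ :=
  (∑ m, z.2 m * dxg (ghat ah) m z.1) - dot z.1 z.2 / ghat ah z.1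

theorem exists_hasFDerivAt_coeffV {ah : Fin 3 → ℝ} {z : Pt3} (hz : z ∈ Wset ah) :
    ∃ (s' : Pt3 →L[ℝ] ℝ) (σ : Fin 3 → ℝ), HasFDerivAt (coeffV ah) s' z ∧
      ∀ v, s' v = ∑ m, (σ m * v.1 m + (dxg (ghat ah) m z.1 - (ghat ah z.1)⁻¹ * z.1 m) * v.2 m) := by
  have hg := contDiffAt_ghat hz
  have hg0 : ghat ah z.1 ≠ 0 := (Real.sqrt_pos.2 hz).ne'
  have hd : DifferentiableAt ℝ (fderiv ℝ (ghat ah)) z.1 :=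
    (hg.fderiv_right (m := 1) (by norm_num)).differentiableAt (by norm_num)
  have hG : ∀ m, DifferentiableAt ℝ (dxg (ghat ah) m) z.1 := fun m =>
    hd.clm_apply (differentiableAt_const _)
  have hgd := hg.differentiableAt (by norm_num)
  have hinv : HasFDerivAt (fun y : Pt3 => (ghat ah y.1)⁻¹) _ z :=
    (hgd.inv hg0).hasFDerivAt.comp z hasFDerivAt_fst
  have key := (HasFDerivAt.fun_sum (u := Finset.univ) fun m _ =>
    (hasFDerivAt_snd_apply z m).mul ((hG m).hasFDerivAt.comp z hasFDerivAt_fst)).sub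
    ((HasFDerivAt.fun_sum (u := Finset.univ) fun m _ =>
      (hasFDerivAt_fst_apply z m).mul (hasFDerivAt_snd_apply z m)).mul hinv)
  refine ⟨_, fun m => (∑ i, z.2 i * fderiv ℝ (dxg (ghat ah) i) z.1 (Pi.single m 1))
    - (ghat ah z.1)⁻¹ * z.2 m
    - (∑ i, z.1 i * z.2 i) * fderiv ℝ (ghat ah)⁻¹ z.1 (Pi.single m 1),
    key, fun v => ?_⟩
  have e1 := fun i => apply_eq_sum_mul_single (fderiv ℝ (dxg (ghat ah) i) z.1) v.1
  have e2 := apply_eq_sum_mul_single (fderiv ℝ (ghat ah)⁻¹ z.1) v.1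
  simp [e1, e2, Fin.sum_univ_three]
  ring

theorem hasFDerivAt_ghat_fst {ah : Fin 3 → ℝ} {z : Pt3} (hz : z ∈ Wset ah) :
    ∃ g' : Pt3 →L[ℝ] ℝ, HasFDerivAt (fun y : Pt3 => ghat ah y.1) g' z ∧
      ∀ v, g' v = ∑ m, dxg (ghat ah) m z.1 * v.1 m := by
  refine ⟨_, ((contDiffAt_ghat hz).differentiableAt (by norm_num)).hasFDerivAt.comp z
    hasFDerivAt_fst, fun v => ?_⟩
  simp only [ContinuousLinearMap.comp_apply, ContinuousLinearMap.coe_fst']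
  rw [apply_eq_sum_mul_single]
  exact Finset.sum_congr rfl fun m _ => mul_comm _ _

theorem structTerm_structMatrixDeriv (A' B' : Fin 3 → Fin 3 → Pt3 →L[ℝ] ℝ) (f h : Pt3 → ℝ)
    (z v : Pt3) :
    structTerm coordVec (structMatrixDeriv A' B') f h z v = ∑ i, ∑ j,
      (dM f i z * A' i j v * dx h j z - dx f j z * A' i j v * dM h i z
        + dM f i z * B' i j v * dM h j z) := by
  simp only [structTerm, Fintype.sum_sum_type, structMatrixDeriv, coordVec, Sum.elim_inl,
    Sum.elim_inr, dx, dM, Fin.sum_univ_three, zero_apply, neg_apply]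
  ring

theorem hamVec_structMatrix_fst (Axm Bmm : Fin 3 → Fin 3 → Pt3 → ℝ) (f : Pt3 → ℝ) (z : Pt3)
    (j : Fin 3) :
    (hamVec coordVec (structMatrix Axm Bmm) f z).1 j = ∑ i, dM f i z * Axm i j z := by
  simp [hamVec, Fintype.sum_sum_type, structMatrix, coordVec, dM, Prod.fst_sum, Pi.single_apply]

theorem hamVec_structMatrix_snd (Axm Bmm : Fin 3 → Fin 3 → Pt3 → ℝ) (f : Pt3 → ℝ) (z : Pt3)
    (j : Fin 3) :
    (hamVec coordVec (structMatrix Axm Bmm) f z).2 j =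
      ∑ i, (dM f i z * Bmm i j z - dx f i z * Axm j i z) := by
  simp [hamVec, Fintype.sum_sum_type, structMatrix, coordVec, dM, dx, Prod.snd_sum,
    Pi.single_apply, Finset.sum_sub_distrib]
  ring

/-- the Veselova bracket {·,·}_v satisfies the Jacobi identity on `W`. -/
theorem jacobi_vesBracket (ah : Fin 3 → ℝ) (f h k : Pt3 → ℝ)
    (hf : ContDiffOn ℝ (⊤ : ℕ∞) f (Wset ah)) (hh : ContDiffOn ℝ (⊤ : ℕ∞) h (Wset ah))
    (hk : ContDiffOn ℝ (⊤ : ℕ∞) k (Wset ah)) :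
    ∀ z ∈ Wset ah,
      vesBracket ah f (vesBracket ah h k) z + vesBracket ah h (vesBracket ah k f) z
        + vesBracket ah k (vesBracket ah f h) z = 0 := by
  intro z hz
  have hC : ∀ {u : Pt3 → ℝ}, ContDiffOn ℝ (⊤ : ℕ∞) u (Wset ah) → ContDiffAt ℝ 2 u z := fun hu =>
    (hu.contDiffAt ((isOpen_Wset ah).mem_nhds hz)).of_le (WithTop.coe_le_coe.2 le_top)
  obtain ⟨g', hg', hg'v⟩ := hasFDerivAt_ghat_fst hz
  obtain ⟨s', σ, hs', hs'v⟩ := exists_hasFDerivAt_coeffV hz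
  have hA : ∀ i j, HasFDerivAt (AxmV ah i j) _ z := fun i j =>
    HasFDerivAt.fun_sum (u := Finset.univ) fun k _ =>
      (hg'.const_mul (eps i j k)).mul (hasFDerivAt_fst_apply z k)
  have hB : ∀ i j, HasFDerivAt (BmmV ah i j) _ z := fun i j =>
    HasFDerivAt.fun_sum (u := Finset.univ) fun k _ =>
      ((hg'.mul (hasFDerivAt_snd_apply z k)).add ((hasFDerivAt_fst_apply z k).mul hs')).const_mul
        (eps i j k)
  have hskew : ∀ i j, BmmV ah i j z = -BmmV ah j i z := fun i j => by
    simp only [BmmV, eps_swap j i, neg_mul, Finset.sum_neg_distrib]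
  have hv : vesBracket ah = coordBracket coordVec (structMatrix (AxmV ah) (BmmV ah)) := by
    funext u w
    exact piBracket_eq_coordBracket _ _ u w
  have hBz : ∀ i j, BmmV ah i j z = ∑ k, eps i j k * (ghat ah z.1 * z.2 k
      + z.1 k * coeffV ah z) := fun _ _ => rfl
  rw [hv, coordBracket_jacobiator (structMatrix_skew hskew) (hasFDerivAt_structMatrix hA hB)
    (hC hf) (hC hh) (hC hk)]
  simp only [structTerm_structMatrixDeriv, sum_apply, add_apply, smul_apply, smul_eq_mul,
    ContinuousLinearMap.comp_apply, ContinuousLinearMap.coe_fst', ContinuousLinearMap.coe_snd',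
    ContinuousLinearMap.proj_apply, hg'v, hs'v, hamVec_structMatrix_fst,
    hamVec_structMatrix_snd, AxmV, hBz]
  generalize dxg (ghat ah) = γ
  generalize coeffV ah z = s
  generalize ghat ah z.1 = g
  generalize g⁻¹ = t
  generalize z.1 = x
  generalize z.2 = K
  simp [Fin.sum_univ_three, eps]
  ring
end
end
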